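/- Every RSOIRE is a SOIRE, and (provided the alphabet Σ contains at least four distinct symbols) there exists a SOIRE over Σ that is not an RSOIRE; hence the class of RSOIREs is a proper subclass of the class of SOIREs. -/

import Mathlib

/-- Regular expressions with interleaving over an alphabet `α`. -/
inductive IExpr (α : Type) where
  | eps   : IExpr α
  | sym   : α → IExpr α
  | cat   : IExpr α → IExpr α → IExpr α
  | alt   : IExpr α → IExpr α → IExpr α
  | star  : IExpr α → IExpr α
  | plus  : IExpr α → IExpr α
  | inter : IExpr α → IExpr α → IExpr α

namespace IExpr

/-- The list of alphabet-symbol occurrences in an expression. -/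
def symbols {α : Type} : IExpr α → List α
  | eps => []
  | sym a => [a]
  | cat r s => symbols r ++ symbols s
  | alt r s => symbols r ++ symbols s
  | star r => symbols r
  | plus r => symbols r
  | inter r s => symbols r ++ symbols s

/-- An expression is single-occurrence if every alphabet symbol occurs at most once in it. -/
def SingleOccurrence {α : Type} (r : IExpr α) : Prop := (symbols r).Nodup

/-- A SOIRE is a single-occurrence regular expression with interleaving. -/
def SOIRE {α : Type} (r : IExpr α) : Prop := SingleOccurrence r

mutual
  /-- The nonterminal `T := T|T | T·T | ε | a | a* | a⁺` of the RSOIRE grammar. -/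
  inductive GT {α : Type} : IExpr α → Prop where
    | alt  : ∀ {r s : IExpr α}, GT r → GT s → GT (IExpr.alt r s)
    | cat  : ∀ {r s : IExpr α}, GT r → GT s → GT (IExpr.cat r s)
    | eps  : GT IExpr.eps
    | sym  : ∀ a : α, GT (IExpr.sym a)
    | star : ∀ a : α, GT (IExpr.star (IExpr.sym a))
    | plus : ∀ a : α, GT (IExpr.plus (IExpr.sym a))

  /-- The nonterminal `S := S&S | T` of the RSOIRE grammar. -/
  inductive GS {α : Type} : IExpr α → Prop where
    | inter : ∀ {r s : IExpr α}, GS r → GS s → GS (IExpr.inter r s)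
    | ofT   : ∀ {r : IExpr α}, GT r → GS r

  /-- The start nonterminal `P := S·P | P·S | S | T | P|S` of the RSOIRE grammar. -/
  inductive GP {α : Type} : IExpr α → Prop where
    | catSP : ∀ {r s : IExpr α}, GS r → GP s → GP (IExpr.cat r s)
    | catPS : ∀ {r s : IExpr α}, GP r → GS s → GP (IExpr.cat r s)
    | ofS   : ∀ {r : IExpr α}, GS r → GP r
    | ofT   : ∀ {r : IExpr α}, GT r → GP r
    | altPS : ∀ {r s : IExpr α}, GP r → GS s → GP (IExpr.alt r s)
end

/-- An RSOIRE is a single-occurrence expression generated by the RSOIRE grammar. -/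
def RSOIRE {α : Type} (r : IExpr α) : Prop := GP r ∧ SingleOccurrence r

end IExpr

open IExpr in
theorem rsoire_proper_subclass_of_soire {α : Type} :
    (∀ r : IExpr α, RSOIRE r → SOIRE r) ∧
    (∀ a b c d : α, a ≠ b → a ≠ c → a ≠ d → b ≠ c → b ≠ d → c ≠ d →
      ∃ r : IExpr α, SOIRE r ∧ ¬ RSOIRE r) := by
  refine ⟨fun r h => h.2, fun a b c d hab hac had hbc hbd hcd => ?_⟩
  -- the witness `a & (b | (c & d))`
  refine ⟨.inter (.sym a) (.alt (.sym b) (.inter (.sym c) (.sym d))), ?_, ?_⟩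
  · simp [SOIRE, SingleOccurrence, symbols, hab, hac, had, hbc, hbd, hcd]
  · rintro ⟨h, -⟩
    have hT : ∀ r s : IExpr α, ¬ GT (.inter r s) := fun r s h => by cases h
    have hS : ¬ GS (IExpr.inter (.sym a) (.alt (.sym b) (.inter (.sym c) (.sym d)))) := by
      intro h
      cases h with
      | ofT h => exact hT _ _ h
      | inter _ h =>
        cases h with
        | ofT h =>
          cases h with
          | alt _ h => exact hT _ _ h
    cases h with
    | ofS h => exact hS h
    | ofT h => exact hT _ _ h
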